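/- arXiv:2003.03687 — 6 statements merged into one kernel-verified Lean document; each statement's English description precedes it below -/
import Mathlib

section
/- Let f : ℝ³ → ℝ be twice continuously differentiable, let z : ℝ² → ℝ be twice differentiable on an open neighborhood U of (x₀, y₀) with f(x, y, z(x, y)) = 0 for all (x, y) ∈ U, and suppose f_z ≠ 0 at the point p = (x₀, y₀, z(x₀, y₀)). Then the Gaussian curvature of the graph of z at (x₀, y₀), namely K = (z_xx z_yy − z_xy²)/(1 + z_x² + z_y²)², equals [(2 f_x f_z f_xz − f_xx f_z² − f_zz f_x²)(2 f_y f_z f_yz − f_yy f_z² − f_zz f_y²) − (f_x f_z f_yz + f_y f_z f_xz − f_x f_y f_zz − f_xy f_z²)²] / [f_z² (f_x² + f_y² + f_z²)²], where all partial derivatives of f are evaluated at p. -/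
/-- Partial derivative of `z : ℝ → ℝ → ℝ` with respect to the first variable. -/
noncomputable def pdx2 (z : ℝ → ℝ → ℝ) (x y : ℝ) : ℝ := deriv (fun t => z t y) x

/-- Partial derivative of `z : ℝ → ℝ → ℝ` with respect to the second variable. -/
noncomputable def pdy2 (z : ℝ → ℝ → ℝ) (x y : ℝ) : ℝ := deriv (fun t => z x t) y

/-- Partial derivative of `f : ℝ → ℝ → ℝ → ℝ` with respect to the first variable. -/
noncomputable def pdx3 (f : ℝ → ℝ → ℝ → ℝ) (x y z : ℝ) : ℝ := deriv (fun t => f t y z) x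

/-- Partial derivative of `f : ℝ → ℝ → ℝ → ℝ` with respect to the second variable. -/
noncomputable def pdy3 (f : ℝ → ℝ → ℝ → ℝ) (x y z : ℝ) : ℝ := deriv (fun t => f x t z) y

/-- Partial derivative of `f : ℝ → ℝ → ℝ → ℝ` with respect to the third variable. -/
noncomputable def pdz3 (f : ℝ → ℝ → ℝ → ℝ) (x y z : ℝ) : ℝ := deriv (fun t => f x y t) z

open Filter Topology

section Partials

variable {g f : ℝ → ℝ → ℝ → ℝ} {z : ℝ → ℝ → ℝ}

theorem fderiv_uncurry_three_apply {x y w : ℝ}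
    (hg : DifferentiableAt ℝ (fun p : ℝ × ℝ × ℝ => g p.1 p.2.1 p.2.2) (x, y, w)) (a b c : ℝ) :
    fderiv ℝ (fun p : ℝ × ℝ × ℝ => g p.1 p.2.1 p.2.2) (x, y, w) (a, b, c) =
      a * pdx3 g x y w + b * pdy3 g x y w + c * pdz3 g x y w := by
  have hx : pdx3 g x y w =
      fderiv ℝ (fun p : ℝ × ℝ × ℝ => g p.1 p.2.1 p.2.2) (x, y, w) (1, 0, 0) :=
    (hg.hasFDerivAt.comp_hasDerivAt (f := fun t : ℝ => (t, y, w)) x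
      ((hasDerivAt_id x).prodMk ((hasDerivAt_const x y).prodMk (hasDerivAt_const x w)))).deriv
  have hy : pdy3 g x y w =
      fderiv ℝ (fun p : ℝ × ℝ × ℝ => g p.1 p.2.1 p.2.2) (x, y, w) (0, 1, 0) :=
    (hg.hasFDerivAt.comp_hasDerivAt (f := fun t : ℝ => (x, t, w)) y
      ((hasDerivAt_const y x).prodMk ((hasDerivAt_id y).prodMk (hasDerivAt_const y w)))).deriv
  have hz : pdz3 g x y w =
      fderiv ℝ (fun p : ℝ × ℝ × ℝ => g p.1 p.2.1 p.2.2) (x, y, w) (0, 0, 1) :=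
    (hg.hasFDerivAt.comp_hasDerivAt (f := fun t : ℝ => (x, y, t)) w
      ((hasDerivAt_const w x).prodMk ((hasDerivAt_const w y).prodMk (hasDerivAt_id w)))).deriv
  have hv : ((a, b, c) : ℝ × ℝ × ℝ) =
      a • ((1, 0, 0) : ℝ × ℝ × ℝ) + b • ((0, 1, 0) : ℝ × ℝ × ℝ) + c • ((0, 0, 1) : ℝ × ℝ × ℝ) := by
    simp
  rw [hv, map_add, map_add, map_smul, map_smul, map_smul, hx, hy, hz]
  simp only [smul_eq_mul]

/-- Chain rule in terms of partial derivatives. -/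
theorem hasDerivAt_comp_three {u v w : ℝ → ℝ} {u' v' w' t : ℝ}
    (hg : DifferentiableAt ℝ (fun p : ℝ × ℝ × ℝ => g p.1 p.2.1 p.2.2) (u t, v t, w t))
    (hu : HasDerivAt u u' t) (hv : HasDerivAt v v' t) (hw : HasDerivAt w w' t) :
    HasDerivAt (fun s => g (u s) (v s) (w s))
      (u' * pdx3 g (u t) (v t) (w t) + v' * pdy3 g (u t) (v t) (w t)
        + w' * pdz3 g (u t) (v t) (w t)) t := by
  rw [← fderiv_uncurry_three_apply hg]
  exact hg.hasFDerivAt.comp_hasDerivAt (f := fun s => (u s, v s, w s)) t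
    (hu.prodMk (hv.prodMk hw))

theorem hasDerivAt_pdx2 {x y : ℝ}
    (hz : DifferentiableAt ℝ (fun p : ℝ × ℝ => z p.1 p.2) (x, y)) :
    HasDerivAt (fun t => z t y) (pdx2 z x y) x :=
  (hz.comp (f := fun t : ℝ => (t, y)) x (by fun_prop)).hasDerivAt

theorem hasDerivAt_pdy2 {x y : ℝ}
    (hz : DifferentiableAt ℝ (fun p : ℝ × ℝ => z p.1 p.2) (x, y)) :
    HasDerivAt (fun t => z x t) (pdy2 z x y) y :=
  (hz.comp (f := fun t : ℝ => (x, t)) y (by fun_prop)).hasDerivAt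

theorem pdx2_eq_fderiv {x y : ℝ}
    (hz : DifferentiableAt ℝ (fun p : ℝ × ℝ => z p.1 p.2) (x, y)) :
    pdx2 z x y = fderiv ℝ (fun p : ℝ × ℝ => z p.1 p.2) (x, y) (1, 0) :=
  (hz.hasFDerivAt.comp_hasDerivAt (f := fun t : ℝ => (t, y)) x
    ((hasDerivAt_id x).prodMk (hasDerivAt_const x y))).deriv

theorem pdy2_eq_fderiv {x y : ℝ}
    (hz : DifferentiableAt ℝ (fun p : ℝ × ℝ => z p.1 p.2) (x, y)) :
    pdy2 z x y = fderiv ℝ (fun p : ℝ × ℝ => z p.1 p.2) (x, y) (0, 1) :=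
  (hz.hasFDerivAt.comp_hasDerivAt (f := fun t : ℝ => (x, t)) y
    ((hasDerivAt_const y x).prodMk (hasDerivAt_id y))).deriv

theorem differentiableAt_pdx2 {u : ℝ × ℝ}
    (hz : ∀ᶠ p in 𝓝 u, DifferentiableAt ℝ (fun p : ℝ × ℝ => z p.1 p.2) p)
    (hz' : DifferentiableAt ℝ (fderiv ℝ (fun p : ℝ × ℝ => z p.1 p.2)) u) :
    DifferentiableAt ℝ (fun p : ℝ × ℝ => pdx2 z p.1 p.2) u :=
  (hz'.clm_apply (differentiableAt_const ((1, 0) : ℝ × ℝ))).congr_of_eventuallyEq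
    (hz.mono fun _ hp => pdx2_eq_fderiv hp)

theorem differentiableAt_pdy2 {u : ℝ × ℝ}
    (hz : ∀ᶠ p in 𝓝 u, DifferentiableAt ℝ (fun p : ℝ × ℝ => z p.1 p.2) p)
    (hz' : DifferentiableAt ℝ (fderiv ℝ (fun p : ℝ × ℝ => z p.1 p.2)) u) :
    DifferentiableAt ℝ (fun p : ℝ × ℝ => pdy2 z p.1 p.2) u :=
  (hz'.clm_apply (differentiableAt_const ((0, 1) : ℝ × ℝ))).congr_of_eventuallyEq
    (hz.mono fun _ hp => pdy2_eq_fderiv hp)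

theorem pdx3_uncurry (hf : Differentiable ℝ (fun p : ℝ × ℝ × ℝ => f p.1 p.2.1 p.2.2)) :
    (fun p : ℝ × ℝ × ℝ => pdx3 f p.1 p.2.1 p.2.2) =
      fun p => fderiv ℝ (fun p : ℝ × ℝ × ℝ => f p.1 p.2.1 p.2.2) p (1, 0, 0) := by
  funext ⟨x, y, w⟩
  simp [fderiv_uncurry_three_apply (hf (x, y, w))]

theorem pdy3_uncurry (hf : Differentiable ℝ (fun p : ℝ × ℝ × ℝ => f p.1 p.2.1 p.2.2)) :
    (fun p : ℝ × ℝ × ℝ => pdy3 f p.1 p.2.1 p.2.2) =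
      fun p => fderiv ℝ (fun p : ℝ × ℝ × ℝ => f p.1 p.2.1 p.2.2) p (0, 1, 0) := by
  funext ⟨x, y, w⟩
  simp [fderiv_uncurry_three_apply (hf (x, y, w))]

theorem pdz3_uncurry (hf : Differentiable ℝ (fun p : ℝ × ℝ × ℝ => f p.1 p.2.1 p.2.2)) :
    (fun p : ℝ × ℝ × ℝ => pdz3 f p.1 p.2.1 p.2.2) =
      fun p => fderiv ℝ (fun p : ℝ × ℝ × ℝ => f p.1 p.2.1 p.2.2) p (0, 0, 1) := by
  funext ⟨x, y, w⟩
  simp [fderiv_uncurry_three_apply (hf (x, y, w))]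

theorem differentiable_fderiv_of_contDiff_two {E F : Type*} [NormedAddCommGroup E]
    [NormedSpace ℝ E] [NormedAddCommGroup F] [NormedSpace ℝ F] {h : E → F}
    (hh : ContDiff ℝ 2 h) : Differentiable ℝ (fderiv ℝ h) :=
  (hh.fderiv_right (m := 1) (by norm_num)).differentiable (by norm_num)

theorem fderiv_fderiv_apply_comm {E F : Type*} [NormedAddCommGroup E]
    [NormedSpace ℝ E] [NormedAddCommGroup F] [NormedSpace ℝ F] {h : E → F}
    (hh : ContDiff ℝ 2 h) (p v w : E) :
    fderiv ℝ (fun q => fderiv ℝ h q v) p w = fderiv ℝ (fun q => fderiv ℝ h q w) p v := by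
  have hd := differentiable_fderiv_of_contDiff_two hh p
  rw [fderiv_clm_apply hd (differentiableAt_const v), fderiv_clm_apply hd (differentiableAt_const w)]
  simpa using (hh.contDiffAt.isSymmSndFDerivAt (by simp)).eq w v

theorem differentiable_pdx3 (hf : ContDiff ℝ 2 (fun p : ℝ × ℝ × ℝ => f p.1 p.2.1 p.2.2)) :
    Differentiable ℝ (fun p : ℝ × ℝ × ℝ => pdx3 f p.1 p.2.1 p.2.2) := by
  rw [pdx3_uncurry (hf.differentiable (by norm_num))]
  exact (differentiable_fderiv_of_contDiff_two hf).clm_apply (differentiable_const _)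

theorem differentiable_pdy3 (hf : ContDiff ℝ 2 (fun p : ℝ × ℝ × ℝ => f p.1 p.2.1 p.2.2)) :
    Differentiable ℝ (fun p : ℝ × ℝ × ℝ => pdy3 f p.1 p.2.1 p.2.2) := by
  rw [pdy3_uncurry (hf.differentiable (by norm_num))]
  exact (differentiable_fderiv_of_contDiff_two hf).clm_apply (differentiable_const _)

theorem differentiable_pdz3 (hf : ContDiff ℝ 2 (fun p : ℝ × ℝ × ℝ => f p.1 p.2.1 p.2.2)) :
    Differentiable ℝ (fun p : ℝ × ℝ × ℝ => pdz3 f p.1 p.2.1 p.2.2) := by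
  rw [pdz3_uncurry (hf.differentiable (by norm_num))]
  exact (differentiable_fderiv_of_contDiff_two hf).clm_apply (differentiable_const _)

theorem pdx3_pdz3_comm (hf : ContDiff ℝ 2 (fun p : ℝ × ℝ × ℝ => f p.1 p.2.1 p.2.2))
    (x y w : ℝ) : pdx3 (pdz3 f) x y w = pdz3 (pdx3 f) x y w := by
  have hd := hf.differentiable (by norm_num)
  have h := fderiv_fderiv_apply_comm hf (x, y, w) (0, 0, 1) (1, 0, 0)
  rw [← pdx3_uncurry hd, ← pdz3_uncurry hd, fderiv_uncurry_three_apply (differentiable_pdx3 hf _),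
    fderiv_uncurry_three_apply (differentiable_pdz3 hf _)] at h
  simpa using h

theorem pdy3_pdz3_comm (hf : ContDiff ℝ 2 (fun p : ℝ × ℝ × ℝ => f p.1 p.2.1 p.2.2))
    (x y w : ℝ) : pdy3 (pdz3 f) x y w = pdz3 (pdy3 f) x y w := by
  have hd := hf.differentiable (by norm_num)
  have h := fderiv_fderiv_apply_comm hf (x, y, w) (0, 0, 1) (0, 1, 0)
  rw [← pdy3_uncurry hd, ← pdz3_uncurry hd, fderiv_uncurry_three_apply (differentiable_pdy3 hf _),
    fderiv_uncurry_three_apply (differentiable_pdz3 hf _)] at h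
  simpa using h

/-- Implicit differentiation in the first variable. -/
theorem implicit_pdx {x y : ℝ}
    (hg : DifferentiableAt ℝ (fun p : ℝ × ℝ × ℝ => g p.1 p.2.1 p.2.2) (x, y, z x y))
    (hz : DifferentiableAt ℝ (fun p : ℝ × ℝ => z p.1 p.2) (x, y)) :
    HasDerivAt (fun t => g t y (z t y))
      (pdx3 g x y (z x y) + pdx2 z x y * pdz3 g x y (z x y)) x := by
  simpa using hasDerivAt_comp_three (u := fun t => t) (v := fun _ => y) (w := fun t => z t y)
    hg (hasDerivAt_id x) (hasDerivAt_const x y) (hasDerivAt_pdx2 hz)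

/-- Implicit differentiation in the second variable. -/
theorem implicit_pdy {x y : ℝ}
    (hg : DifferentiableAt ℝ (fun p : ℝ × ℝ × ℝ => g p.1 p.2.1 p.2.2) (x, y, z x y))
    (hz : DifferentiableAt ℝ (fun p : ℝ × ℝ => z p.1 p.2) (x, y)) :
    HasDerivAt (fun t => g x t (z x t))
      (pdy3 g x y (z x y) + pdy2 z x y * pdz3 g x y (z x y)) y := by
  simpa using hasDerivAt_comp_three (u := fun _ => x) (v := fun t => t) (w := fun t => z x t)
    hg (hasDerivAt_const y x) (hasDerivAt_id y) (hasDerivAt_pdy2 hz)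

/-- A function vanishing near `(x, y)` has vanishing derivatives along the coordinate lines. -/
theorem eq_zero_of_hasDerivAt_fst {h : ℝ × ℝ → ℝ} {x y d : ℝ}
    (hh : ∀ᶠ u in 𝓝 (x, y), h u = 0) (hd : HasDerivAt (fun t => h (t, y)) d x) : d = 0 := by
  have hc : Tendsto (fun t : ℝ => (t, y)) (𝓝 x) (𝓝 (x, y)) :=
    Continuous.tendsto (f := fun t : ℝ => (t, y)) (by fun_prop) x
  exact hd.unique ((hasDerivAt_const x (0 : ℝ)).congr_of_eventuallyEq (hc.eventually hh))

theorem eq_zero_of_hasDerivAt_snd {h : ℝ × ℝ → ℝ} {x y d : ℝ}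
    (hh : ∀ᶠ u in 𝓝 (x, y), h u = 0) (hd : HasDerivAt (fun t => h (x, t)) d y) : d = 0 := by
  have hc : Tendsto (fun t : ℝ => (x, t)) (𝓝 y) (𝓝 (x, y)) :=
    Continuous.tendsto (f := fun t : ℝ => (x, t)) (by fun_prop) y
  exact hd.unique ((hasDerivAt_const y (0 : ℝ)).congr_of_eventuallyEq (hc.eventually hh))

end Partials

theorem graph_curvature_identity {fx fy fz fxx fxy fxz fyy fyz fzz zx zy zxx zxy zyy : ℝ}
    (hfz : fz ≠ 0) (hx : fx + zx * fz = 0) (hy : fy + zy * fz = 0)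
    (hxx : fxx + zx * fxz + (zxx * fz + zx * (fxz + zx * fzz)) = 0)
    (hxy : fxy + zy * fxz + (zxy * fz + zx * (fyz + zy * fzz)) = 0)
    (hyy : fyy + zy * fyz + (zyy * fz + zy * (fyz + zy * fzz)) = 0) :
    (zxx * zyy - zxy ^ 2) / (1 + zx ^ 2 + zy ^ 2) ^ 2 =
      ((2 * fx * fz * fxz - fxx * fz ^ 2 - fzz * fx ^ 2) *
        (2 * fy * fz * fyz - fyy * fz ^ 2 - fzz * fy ^ 2)
        - (fx * fz * fyz + fy * fz * fxz - fx * fy * fzz - fxy * fz ^ 2) ^ 2) /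
      (fz ^ 2 * (fx ^ 2 + fy ^ 2 + fz ^ 2) ^ 2) := by
  obtain rfl : fx = -(zx * fz) := by linarith
  obtain rfl : fy = -(zy * fz) := by linarith
  obtain rfl : fxx = -(zx * fxz + (zxx * fz + zx * (fxz + zx * fzz))) := by linarith
  obtain rfl : fxy = -(zy * fxz + (zxy * fz + zx * (fyz + zy * fzz))) := by linarith
  obtain rfl : fyy = -(zy * fyz + (zyy * fz + zy * (fyz + zy * fzz))) := by linarith
  have h₁ : 1 + zx ^ 2 + zy ^ 2 ≠ 0 := by positivity
  have h₂ : (-(zx * fz)) ^ 2 + (-(zy * fz)) ^ 2 + fz ^ 2 ≠ 0 := by positivity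
  rw [div_eq_div_iff (by positivity) (by positivity)]
  ring

/-- The Gaussian curvature `(z_xx z_yy - z_xy²)/(1 + z_x² + z_y²)²` of the graph surface
`(x,y) ↦ (x, y, z(x,y))` implicitly defined by `f(x, y, z(x,y)) = 0` equals the expression
in the partial derivatives of `f`. -/
theorem statement2 (f : ℝ → ℝ → ℝ → ℝ)
    (hf : ContDiff ℝ 2 (fun p : ℝ × ℝ × ℝ => f p.1 p.2.1 p.2.2))
    (z : ℝ → ℝ → ℝ) (U : Set (ℝ × ℝ)) (hU : IsOpen U) (x₀ y₀ : ℝ) (hmem : (x₀, y₀) ∈ U)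
    (hz1 : ∀ u ∈ U, DifferentiableAt ℝ (fun p : ℝ × ℝ => z p.1 p.2) u)
    (hz2 : ∀ u ∈ U, DifferentiableAt ℝ (fderiv ℝ (fun p : ℝ × ℝ => z p.1 p.2)) u)
    (hzero : ∀ u ∈ U, f u.1 u.2 (z u.1 u.2) = 0)
    (z₀ : ℝ) (hz₀ : z₀ = z x₀ y₀)
    (hfz : pdz3 f x₀ y₀ z₀ ≠ 0) :
    (pdx2 (pdx2 z) x₀ y₀ * pdy2 (pdy2 z) x₀ y₀ - (pdy2 (pdx2 z) x₀ y₀) ^ 2) /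
        (1 + (pdx2 z x₀ y₀) ^ 2 + (pdy2 z x₀ y₀) ^ 2) ^ 2 =
      ((2 * pdx3 f x₀ y₀ z₀ * pdz3 f x₀ y₀ z₀ * pdz3 (pdx3 f) x₀ y₀ z₀
          - pdx3 (pdx3 f) x₀ y₀ z₀ * (pdz3 f x₀ y₀ z₀) ^ 2
          - pdz3 (pdz3 f) x₀ y₀ z₀ * (pdx3 f x₀ y₀ z₀) ^ 2) *
        (2 * pdy3 f x₀ y₀ z₀ * pdz3 f x₀ y₀ z₀ * pdz3 (pdy3 f) x₀ y₀ z₀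
          - pdy3 (pdy3 f) x₀ y₀ z₀ * (pdz3 f x₀ y₀ z₀) ^ 2
          - pdz3 (pdz3 f) x₀ y₀ z₀ * (pdy3 f x₀ y₀ z₀) ^ 2)
        - (pdx3 f x₀ y₀ z₀ * pdz3 f x₀ y₀ z₀ * pdz3 (pdy3 f) x₀ y₀ z₀
          + pdy3 f x₀ y₀ z₀ * pdz3 f x₀ y₀ z₀ * pdz3 (pdx3 f) x₀ y₀ z₀
          - pdx3 f x₀ y₀ z₀ * pdy3 f x₀ y₀ z₀ * pdz3 (pdz3 f) x₀ y₀ z₀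
          - pdy3 (pdx3 f) x₀ y₀ z₀ * (pdz3 f x₀ y₀ z₀) ^ 2) ^ 2) /
      ((pdz3 f x₀ y₀ z₀) ^ 2 *
        ((pdx3 f x₀ y₀ z₀) ^ 2 + (pdy3 f x₀ y₀ z₀) ^ 2 + (pdz3 f x₀ y₀ z₀) ^ 2) ^ 2) := by
  subst hz₀
  have hUn := hU.eventually_mem hmem
  have hdf := hf.differentiable (by norm_num)
  have hfx := differentiable_pdx3 hf
  have hfy := differentiable_pdy3 hf
  have hfz' := differentiable_pdz3 hf
  have hz := hz1 _ hmem
  have hzx := differentiableAt_pdx2 (hUn.mono hz1) (hz2 _ hmem)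
  have hzy := differentiableAt_pdy2 (hUn.mono hz1) (hz2 _ hmem)
  have hx : ∀ u ∈ U, pdx3 f u.1 u.2 (z u.1 u.2)
      + pdx2 z u.1 u.2 * pdz3 f u.1 u.2 (z u.1 u.2) = 0 := fun u hu =>
    eq_zero_of_hasDerivAt_fst (h := fun u => f u.1 u.2 (z u.1 u.2))
      ((hU.eventually_mem hu).mono hzero) (implicit_pdx (hdf _) (hz1 u hu))
  have hy : ∀ u ∈ U, pdy3 f u.1 u.2 (z u.1 u.2)
      + pdy2 z u.1 u.2 * pdz3 f u.1 u.2 (z u.1 u.2) = 0 := fun u hu =>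
    eq_zero_of_hasDerivAt_snd (h := fun u => f u.1 u.2 (z u.1 u.2))
      ((hU.eventually_mem hu).mono hzero) (implicit_pdy (hdf _) (hz1 u hu))
  have hxx := eq_zero_of_hasDerivAt_fst (hUn.mono hx)
    ((implicit_pdx (hfx _) hz).add ((hasDerivAt_pdx2 hzx).mul (implicit_pdx (hfz' _) hz)))
  have hxy := eq_zero_of_hasDerivAt_snd (hUn.mono hx)
    ((implicit_pdy (hfx _) hz).add ((hasDerivAt_pdy2 hzx).mul (implicit_pdy (hfz' _) hz)))
  have hyy := eq_zero_of_hasDerivAt_snd (hUn.mono hy)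
    ((implicit_pdy (hfy _) hz).add ((hasDerivAt_pdy2 hzy).mul (implicit_pdy (hfz' _) hz)))
  rw [pdx3_pdz3_comm hf] at hxx
  rw [pdy3_pdz3_comm hf] at hxy hyy
  exact graph_curvature_identity hfz (hx _ hmem) (hy _ hmem) hxx hxy hyy
end

section
/- Let f be a one-hidden-layer neural network with 2D input. Then at every (x, y) ∈ ℝ²: f_xx f_y² − 2 f_x f_y f_xy + f_x² f_yy = ∑_{i,j,k} σᵢ'' σⱼ' σₖ' aᵢ aⱼ aₖ [ W_{i1} W_{k2} (W_{i1} W_{j2} − W_{i2} W_{j1}) + W_{i2} W_{j1} (W_{i2} W_{k1} − W_{i1} W_{k2}) ], where the sum runs over all i, j, k ∈ {1, …, d₁}. -/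
/-- Partial derivative of `f : ℝ → ℝ → ℝ` with respect to the first variable. -/
noncomputable def pdx (f : ℝ → ℝ → ℝ) (x y : ℝ) : ℝ := deriv (fun t => f t y) x

/-- Partial derivative of `f : ℝ → ℝ → ℝ` with respect to the second variable. -/
noncomputable def pdy (f : ℝ → ℝ → ℝ) (x y : ℝ) : ℝ := deriv (fun t => f x t) y

theorem hasDerivAt_sum_comp_affine {ι : Type*} [Fintype ι] {g : ℝ → ℝ} (hg : Differentiable ℝ g)
    (a w b : ι → ℝ) (c t : ℝ) :
    HasDerivAt (fun s => (∑ i, a i * g (w i * s + b i)) + c)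
      (∑ i, a i * w i * deriv g (w i * t + b i)) t := by
  refine (HasDerivAt.fun_sum fun i _ => ?_).add_const c
  have h : HasDerivAt (fun s => w i * s + b i) (w i) t := by
    simpa using ((hasDerivAt_id t).const_mul (w i)).add_const (b i)
  exact (((hg (w i * t + b i)).hasDerivAt.comp t h).const_mul (a i)).congr_deriv (by ring)

theorem pdx_sum_comp_affine {ι : Type*} [Fintype ι] {g : ℝ → ℝ} (hg : Differentiable ℝ g)
    (a u v b : ι → ℝ) (c : ℝ) :
    pdx (fun x y => (∑ i, a i * g (u i * x + v i * y + b i)) + c) =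
      fun x y => (∑ i, a i * u i * deriv g (u i * x + v i * y + b i)) + 0 := by
  funext x y
  simpa only [pdx, add_assoc, add_zero] using
    (hasDerivAt_sum_comp_affine hg a u (fun i => v i * y + b i) c x).deriv

theorem pdy_sum_comp_affine {ι : Type*} [Fintype ι] {g : ℝ → ℝ} (hg : Differentiable ℝ g)
    (a u v b : ι → ℝ) (c : ℝ) :
    pdy (fun x y => (∑ i, a i * g (u i * x + v i * y + b i)) + c) =
      fun x y => (∑ i, a i * v i * deriv g (u i * x + v i * y + b i)) + 0 := by
  funext x y
  simpa only [pdy, add_assoc, add_zero, add_left_comm] using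
    (hasDerivAt_sum_comp_affine hg a v (fun i => u i * x + b i) c y).deriv

theorem sum_sum_sum_mul_mul {ι R : Type*} [Fintype ι] [CommSemiring R] (p q r : ι → R) :
    ∑ i, ∑ j, ∑ k, p i * q j * r k = (∑ i, p i) * (∑ j, q j) * ∑ k, r k := by
  simp only [← Finset.mul_sum, ← Finset.sum_mul]

/-- The curvature numerator `f_xx f_y² − 2 f_x f_y f_xy + f_x² f_yy` of a one-hidden-layer
network with 2D input as a triple sum over hidden units. -/
theorem statement6 (d₁ : ℕ) (a : Fin d₁ → ℝ) (W : Fin d₁ → Fin 2 → ℝ) (b : Fin d₁ → ℝ)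
    (c : ℝ) (σ : ℝ → ℝ) (hσ : ContDiff ℝ 2 σ) (f : ℝ → ℝ → ℝ)
    (hf : ∀ x y, f x y = (∑ i, a i * σ (W i 0 * x + W i 1 * y + b i)) + c)
    (x y : ℝ) :
    pdx (pdx f) x y * (pdy f x y) ^ 2
        - 2 * pdx f x y * pdy f x y * pdy (pdx f) x y
        + (pdx f x y) ^ 2 * pdy (pdy f) x y =
      ∑ i, ∑ j, ∑ k,
        deriv (deriv σ) (W i 0 * x + W i 1 * y + b i) *
          deriv σ (W j 0 * x + W j 1 * y + b j) *
          deriv σ (W k 0 * x + W k 1 * y + b k) *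
          (a i * a j * a k) *
          (W i 0 * W k 1 * (W i 0 * W j 1 - W i 1 * W j 0)
            + W i 1 * W j 0 * (W i 1 * W k 0 - W i 0 * W k 1)) := by
  have hσ₁ : Differentiable ℝ σ := hσ.differentiable (by norm_num)
  have hσ₂ : Differentiable ℝ (deriv σ) :=
    (contDiff_succ_iff_deriv.1 (show ContDiff ℝ (1 + 1) σ by
      simpa [one_add_one_eq_two] using hσ)).2.2.differentiable (by norm_num)
  obtain rfl : f = fun x y => (∑ i, a i * σ (W i 0 * x + W i 1 * y + b i)) + c := by
    funext x y
    exact hf x y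
  rw [pdx_sum_comp_affine hσ₁, pdy_sum_comp_affine hσ₁, pdx_sum_comp_affine hσ₂,
    pdy_sum_comp_affine hσ₂, pdy_sum_comp_affine hσ₂]
  simp only [add_zero]
  set z : Fin d₁ → ℝ := fun i => W i 0 * x + W i 1 * y + b i
  have hxx := sum_sum_sum_mul_mul (fun i => a i * W i 0 * W i 0 * deriv (deriv σ) (z i))
    (fun j => a j * W j 1 * deriv σ (z j)) (fun k => a k * W k 1 * deriv σ (z k))
  have hxy := sum_sum_sum_mul_mul (fun i => a i * W i 0 * W i 1 * deriv (deriv σ) (z i))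
    (fun j => a j * W j 0 * deriv σ (z j)) (fun k => a k * W k 1 * deriv σ (z k))
  have hyy := sum_sum_sum_mul_mul (fun i => a i * W i 1 * W i 1 * deriv (deriv σ) (z i))
    (fun j => a j * W j 0 * deriv σ (z j)) (fun k => a k * W k 0 * deriv σ (z k))
  trans (∑ i, a i * W i 0 * W i 0 * deriv (deriv σ) (z i)) *
        (∑ j, a j * W j 1 * deriv σ (z j)) * (∑ k, a k * W k 1 * deriv σ (z k)) -
      2 * ((∑ i, a i * W i 0 * W i 1 * deriv (deriv σ) (z i)) *
        (∑ j, a j * W j 0 * deriv σ (z j)) * (∑ k, a k * W k 1 * deriv σ (z k))) +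
      (∑ i, a i * W i 1 * W i 1 * deriv (deriv σ) (z i)) *
        (∑ j, a j * W j 0 * deriv σ (z j)) * (∑ k, a k * W k 0 * deriv σ (z k))
  · ring
  · rw [← hxx, ← hxy, ← hyy]
    simp only [Finset.mul_sum, ← Finset.sum_sub_distrib, ← Finset.sum_add_distrib]
    refine Finset.sum_congr rfl fun i _ => Finset.sum_congr rfl fun j _ =>
      Finset.sum_congr rfl fun k _ => ?_
    ring
end

section
/- Let f be a one-hidden-layer neural network with 2D input. If aᵢ aⱼ (W_{i1} W_{j2} − W_{i2} W_{j1}) = 0 for all i, j ∈ {1, …, d₁}, then there exist a vector w ∈ ℝ² and a function g : ℝ → ℝ such that f(p) = g(⟨w, p⟩) for all p ∈ ℝ²; in particular f(p) = f(p') whenever ⟨w, p⟩ = ⟨w, p'⟩, so the decision boundary {p ∈ ℝ² : f(p) = 0} is a union of lines with common normal w (whenever w ≠ 0). -/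
/-- Active planar weight vectors that are pairwise parallel are all multiples of one vector. -/
theorem exists_common_direction {ι : Type*} (a : ι → ℝ) (W : ι → Fin 2 → ℝ)
    (hW : ∀ i j, a i * a j * (W i 0 * W j 1 - W i 1 * W j 0) = 0) :
    ∃ (w : ℝ × ℝ) (t : ι → ℝ), ∀ j, a j ≠ 0 → W j 0 = t j * w.1 ∧ W j 1 = t j * w.2 := by
  by_cases h : ∃ i, a i ≠ 0 ∧ W i 0 ^ 2 + W i 1 ^ 2 ≠ 0
  · obtain ⟨i, hi, hn⟩ := h
    refine ⟨(W i 0, W i 1),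
      fun j => (W j 0 * W i 0 + W j 1 * W i 1) / (W i 0 ^ 2 + W i 1 ^ 2), fun j hj => ?_⟩
    have hdet : W i 0 * W j 1 - W i 1 * W j 0 = 0 :=
      (mul_eq_zero.mp (hW i j)).resolve_left (mul_ne_zero hi hj)
    constructor
    · rw [div_mul_eq_mul_div, eq_div_iff hn]
      linear_combination -(W i 1) * hdet
    · rw [div_mul_eq_mul_div, eq_div_iff hn]
      linear_combination W i 0 * hdet
  · push Not at h
    refine ⟨0, 0, fun j hj => ?_⟩
    have hz := h j hj
    constructor
    · simpa using (by nlinarith [sq_nonneg (W j 0), sq_nonneg (W j 1)] : W j 0 ^ 2 = 0)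
    · simpa using (by nlinarith [sq_nonneg (W j 0), sq_nonneg (W j 1)] : W j 1 ^ 2 = 0)

/-- If `aᵢ aⱼ (W_{i1} W_{j2} − W_{i2} W_{j1}) = 0` for all `i, j`, then a one-hidden-layer
network with 2D input is a function of a single linear form `⟨w, p⟩`; in particular its
value is constant on each line `⟨w, p⟩ = const`, so the decision boundary is a union of
lines with common normal `w`. -/
theorem statement8 (d₁ : ℕ) (a : Fin d₁ → ℝ) (W : Fin d₁ → Fin 2 → ℝ) (b : Fin d₁ → ℝ)
    (c : ℝ) (σ : ℝ → ℝ) (hσ : ContDiff ℝ 2 σ) (f : ℝ → ℝ → ℝ)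
    (hf : ∀ x y, f x y = (∑ i, a i * σ (W i 0 * x + W i 1 * y + b i)) + c)
    (hW : ∀ i j, a i * a j * (W i 0 * W j 1 - W i 1 * W j 0) = 0) :
    ∃ (w : ℝ × ℝ) (g : ℝ → ℝ),
      (∀ p : ℝ × ℝ, f p.1 p.2 = g (w.1 * p.1 + w.2 * p.2)) ∧
      (∀ p p' : ℝ × ℝ, w.1 * p.1 + w.2 * p.2 = w.1 * p'.1 + w.2 * p'.2 →
        f p.1 p.2 = f p'.1 p'.2) := by
  obtain ⟨w, t, ht⟩ := exists_common_direction a W hW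
  have hg : ∀ p : ℝ × ℝ,
      f p.1 p.2 = (∑ i, a i * σ (t i * (w.1 * p.1 + w.2 * p.2) + b i)) + c := by
    intro p
    rw [hf]
    congr 1
    refine Finset.sum_congr rfl fun i _ => ?_
    by_cases hi : a i = 0
    · simp [hi]
    · rw [(ht i hi).1, (ht i hi).2]
      ring_nf
  exact ⟨w, fun s => (∑ i, a i * σ (t i * s + b i)) + c, hg,
    fun p p' h => by rw [hg p, hg p', h]⟩
end

section
/- Let f be a one-hidden-layer neural network with 2D input. Suppose either (a) there exists a column p ∈ {1, 2} such that aᵢ W_{ip} = 0 for all i ∈ {1, …, d₁}, or (b) aᵢ aⱼ (W_{i1} W_{j2} − W_{i2} W_{j1}) = 0 for all i, j ∈ {1, …, d₁}. Then f_xx f_y² − 2 f_x f_y f_xy + f_x² f_yy = 0 at every point of ℝ²; consequently the planar curvature k = |(f_xx f_y² − 2 f_x f_y f_xy + f_x² f_yy)/f_y³| (1 + f_x²/f_y²)^{-3/2} of the decision boundary is zero at every point where f_y ≠ 0. -/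
lemma pdx_network {ι : Type*} [Fintype ι] (a : ι → ℝ) (W : ι → Fin 2 → ℝ) (b : ι → ℝ) (c : ℝ)
    {σ : ℝ → ℝ} (hσ : Differentiable ℝ σ) :
    pdx (fun x y => (∑ i, a i * σ (W i 0 * x + W i 1 * y + b i)) + c) =
      fun x y => (∑ i, a i * W i 0 * deriv σ (W i 0 * x + W i 1 * y + b i)) + 0 := by
  funext x y
  refine HasDerivAt.deriv ?_
  rw [add_zero]
  refine HasDerivAt.add_const c (HasDerivAt.fun_sum fun i _ => ?_)
  have hlin : HasDerivAt (fun t : ℝ => W i 0 * t + W i 1 * y + b i) (W i 0) x := by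
    simpa using (((hasDerivAt_id x).const_mul (W i 0)).add_const (W i 1 * y)).add_const (b i)
  refine (((hσ _).hasDerivAt.comp x hlin).const_mul (a i)).congr_deriv ?_
  ring

lemma pdy_network {ι : Type*} [Fintype ι] (a : ι → ℝ) (W : ι → Fin 2 → ℝ) (b : ι → ℝ) (c : ℝ)
    {σ : ℝ → ℝ} (hσ : Differentiable ℝ σ) :
    pdy (fun x y => (∑ i, a i * σ (W i 0 * x + W i 1 * y + b i)) + c) =
      fun x y => (∑ i, a i * W i 1 * deriv σ (W i 0 * x + W i 1 * y + b i)) + 0 := by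
  funext x y
  refine HasDerivAt.deriv ?_
  rw [add_zero]
  refine HasDerivAt.add_const c (HasDerivAt.fun_sum fun i _ => ?_)
  have hlin : HasDerivAt (fun t : ℝ => W i 0 * x + W i 1 * t + b i) (W i 1) y := by
    simpa using (((hasDerivAt_id y).const_mul (W i 1)).const_add (W i 0 * x)).add_const (b i)
  refine (((hσ _).hasDerivAt.comp y hlin).const_mul (a i)).congr_deriv ?_
  ring

/-- The curvature numerator of a network is a sum over neurons of terms that vanish when any two
active neurons have parallel weight vectors. -/
lemma curvature_numerator_eq_zero {ι : Type*} [Fintype ι] (a : ι → ℝ) (W : ι → Fin 2 → ℝ)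
    (h : ∀ i j, a i * a j * (W i 0 * W j 1 - W i 1 * W j 0) = 0) (s r : ι → ℝ) :
    (∑ i, a i * W i 0 * W i 0 * r i) * (∑ i, a i * W i 1 * s i) ^ 2
      - 2 * (∑ i, a i * W i 0 * s i) * (∑ i, a i * W i 1 * s i) * (∑ i, a i * W i 0 * W i 1 * r i)
      + (∑ i, a i * W i 0 * s i) ^ 2 * (∑ i, a i * W i 1 * W i 1 * r i) = 0 := by
  have key : ∀ k, a k * (W k 0 * (∑ i, a i * W i 1 * s i) - W k 1 * ∑ i, a i * W i 0 * s i)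
      = 0 := by
    intro k
    rw [Finset.mul_sum, Finset.mul_sum, ← Finset.sum_sub_distrib, Finset.mul_sum]
    refine Finset.sum_eq_zero fun j _ => ?_
    linear_combination s j * h k j
  generalize (∑ i, a i * W i 1 * s i) = v at key ⊢
  generalize (∑ i, a i * W i 0 * s i) = u at key ⊢
  rw [Finset.sum_mul, Finset.mul_sum, Finset.mul_sum, ← Finset.sum_sub_distrib,
    ← Finset.sum_add_distrib]
  refine Finset.sum_eq_zero fun k _ => ?_
  linear_combination r k * (W k 0 * v - W k 1 * u) * key k

/-- Sufficient conditions on the parameters of a one-hidden-layer network with 2D input for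
the curvature numerator `f_xx f_y² − 2 f_x f_y f_xy + f_x² f_yy` to vanish identically,
hence for the planar curvature of the decision boundary to be zero wherever `f_y ≠ 0`. -/
theorem statement9 (d₁ : ℕ) (a : Fin d₁ → ℝ) (W : Fin d₁ → Fin 2 → ℝ) (b : Fin d₁ → ℝ)
    (c : ℝ) (σ : ℝ → ℝ) (hσ : ContDiff ℝ 2 σ) (f : ℝ → ℝ → ℝ)
    (hf : ∀ x y, f x y = (∑ i, a i * σ (W i 0 * x + W i 1 * y + b i)) + c)
    (hW : (∃ p : Fin 2, ∀ i, a i * W i p = 0) ∨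
      (∀ i j, a i * a j * (W i 0 * W j 1 - W i 1 * W j 0) = 0)) :
    (∀ x y : ℝ,
      pdx (pdx f) x y * (pdy f x y) ^ 2
        - 2 * pdx f x y * pdy f x y * pdy (pdx f) x y
        + (pdx f x y) ^ 2 * pdy (pdy f) x y = 0) ∧
    (∀ x y : ℝ, pdy f x y ≠ 0 →
      |(pdx (pdx f) x y * (pdy f x y) ^ 2
          - 2 * pdx f x y * pdy f x y * pdy (pdx f) x y
          + (pdx f x y) ^ 2 * pdy (pdy f) x y) / (pdy f x y) ^ 3|
        * (1 + (pdx f x y) ^ 2 / (pdy f x y) ^ 2) ^ (-(3 : ℝ) / 2) = 0) := by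
  have hpar : ∀ i j, a i * a j * (W i 0 * W j 1 - W i 1 * W j 0) = 0 := by
    rcases hW with ⟨p, hp⟩ | h
    · intro i j
      fin_cases p
      · have hi : a i * W i 0 = 0 := hp i
        have hj : a j * W j 0 = 0 := hp j
        linear_combination a j * W j 1 * hi - a i * W i 1 * hj
      · have hi : a i * W i 1 = 0 := hp i
        have hj : a j * W j 1 = 0 := hp j
        linear_combination a i * W i 0 * hj - a j * W j 0 * hi
    · exact h
  have hσ₁ : Differentiable ℝ σ := hσ.differentiable (by norm_num)
  have hσ₂ : Differentiable ℝ (deriv σ) := by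
    have h : ContDiff ℝ (1 + 1) σ := by
      rw [one_add_one_eq_two]
      exact hσ
    exact (contDiff_succ_iff_deriv.mp h).2.2.differentiable (by norm_num)
  obtain rfl : f = fun x y => (∑ i, a i * σ (W i 0 * x + W i 1 * y + b i)) + c :=
    funext fun x => funext fun y => hf x y
  have hnum := fun x y : ℝ => curvature_numerator_eq_zero a W hpar
    (fun i => deriv σ (W i 0 * x + W i 1 * y + b i))
    (fun i => deriv (deriv σ) (W i 0 * x + W i 1 * y + b i))
  simp only [pdx_network _ W b _ hσ₁, pdy_network _ W b _ hσ₁, pdx_network _ W b _ hσ₂,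
    pdy_network _ W b _ hσ₂]
  simp only [add_zero]
  refine ⟨hnum, fun x y _ => ?_⟩
  rw [hnum x y, zero_div, abs_zero, zero_mul]
end

section
/- Let f be a one-hidden-layer neural network with 3D input. Then at every (x, y, z) ∈ ℝ³: (2 f_xz f_x f_z − f_xx f_z² − f_zz f_x²)(2 f_yz f_y f_z − f_yy f_z² − f_zz f_y²) − (f_yz f_x f_z + f_xz f_y f_z − f_zz f_x f_y − f_xy f_z²)² = ∑_{i,j,k,l,m,n} aᵢ aⱼ aₖ a_l a_m a_n σᵢ'' σⱼ' σₖ' σ_l'' σ_m' σ_n' { [ W_{i1} W_{k3} (W_{i3} W_{j1} − W_{i1} W_{j3}) + W_{i3} W_{j1} (W_{i1} W_{k3} − W_{i3} W_{k1}) ] · [ W_{l2} W_{n3} (W_{l3} W_{m2} − W_{l2} W_{m3}) + W_{l3} W_{m2} (W_{l2} W_{n3} − W_{l3} W_{n2}) ] − [ W_{i3} W_{j1} (W_{i2} W_{k3} − W_{i3} W_{k2}) + W_{i1} W_{k3} (W_{i3} W_{j2} − W_{i2} W_{j3}) ] · [ W_{l3} W_{m1} (W_{l2} W_{n3} − W_{l3}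 W_{n2}) + W_{l1} W_{n3} (W_{l3} W_{m2} − W_{l2} W_{m3}) ] }, where the sum runs over all i, j, k, l, m, n ∈ {1, …, d₁}. -/
/-- Derivative of a finite linear combination of `g` composed with inner functions, plus a
constant. -/
theorem deriv_sum_mul_comp_add_const {ι : Type*} [Fintype ι] {g : ℝ → ℝ}
    (hg : Differentiable ℝ g) (w p : ι → ℝ) (θ : ι → ℝ → ℝ) (c t : ℝ)
    (hθ : ∀ i, HasDerivAt (θ i) (p i) t) :
    deriv (fun s => (∑ i, w i * g (θ i s)) + c) t = ∑ i, w i * p i * deriv g (θ i t) := by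
  have h : HasDerivAt (fun s => (∑ i, w i * g (θ i s)) + c)
      (∑ i, w i * (deriv g (θ i t) * p i)) t :=
    (HasDerivAt.fun_sum fun i _ =>
      ((hg (θ i t)).hasDerivAt.comp t (hθ i)).const_mul (w i)).add_const c
  rw [h.deriv]
  exact Finset.sum_congr rfl fun i _ => by ring

theorem hasDerivAt_mul_add_const (p q t : ℝ) : HasDerivAt (fun s => p * s + q) p t := by
  simpa using ((hasDerivAt_id t).const_mul p).add_const q

theorem pdx3_network {ι : Type*} [Fintype ι] {g : ℝ → ℝ} (hg : Differentiable ℝ g)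
    (w : ι → ℝ) (W : ι → Fin 3 → ℝ) (b : ι → ℝ) (c : ℝ) :
    pdx3 (fun x y z => (∑ i, w i * g (W i 0 * x + W i 1 * y + W i 2 * z + b i)) + c) =
      fun x y z => (∑ i, w i * W i 0 * deriv g (W i 0 * x + W i 1 * y + W i 2 * z + b i)) + 0 := by
  funext x y z
  rw [add_zero]
  refine deriv_sum_mul_comp_add_const hg w (fun i => W i 0)
    (fun i t => W i 0 * t + W i 1 * y + W i 2 * z + b i) c x fun i => ?_
  simpa only [add_assoc] using hasDerivAt_mul_add_const (W i 0) (W i 1 * y + (W i 2 * z + b i)) x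

theorem pdy3_network {ι : Type*} [Fintype ι] {g : ℝ → ℝ} (hg : Differentiable ℝ g)
    (w : ι → ℝ) (W : ι → Fin 3 → ℝ) (b : ι → ℝ) (c : ℝ) :
    pdy3 (fun x y z => (∑ i, w i * g (W i 0 * x + W i 1 * y + W i 2 * z + b i)) + c) =
      fun x y z => (∑ i, w i * W i 1 * deriv g (W i 0 * x + W i 1 * y + W i 2 * z + b i)) + 0 := by
  funext x y z
  rw [add_zero]
  refine deriv_sum_mul_comp_add_const hg w (fun i => W i 1)
    (fun i t => W i 0 * x + W i 1 * t + W i 2 * z + b i) c y fun i => ?_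
  simpa only [add_assoc, add_left_comm (W i 0 * x)] using
    hasDerivAt_mul_add_const (W i 1) (W i 0 * x + (W i 2 * z + b i)) y

theorem pdz3_network {ι : Type*} [Fintype ι] {g : ℝ → ℝ} (hg : Differentiable ℝ g)
    (w : ι → ℝ) (W : ι → Fin 3 → ℝ) (b : ι → ℝ) (c : ℝ) :
    pdz3 (fun x y z => (∑ i, w i * g (W i 0 * x + W i 1 * y + W i 2 * z + b i)) + c) =
      fun x y z => (∑ i, w i * W i 2 * deriv g (W i 0 * x + W i 1 * y + W i 2 * z + b i)) + 0 := by
  funext x y z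
  rw [add_zero]
  refine deriv_sum_mul_comp_add_const hg w (fun i => W i 2)
    (fun i t => W i 0 * x + W i 1 * y + W i 2 * t + b i) c z fun i => ?_
  exact ((hasDerivAt_mul_add_const (W i 2) (W i 0 * x + W i 1 * y) z).congr_of_eventuallyEq
    (.of_forall fun t => add_comm _ _)).add_const (b i)

/-- The quadratic form in first-order moments `∑ β p`, linear in second-order moments `∑ α p q`,
written as a triple sum. -/
theorem sum_sum_sum_curvature_form {ι : Type*} [Fintype ι] (α β p q r : ι → ℝ) :
    ∑ i, ∑ j, ∑ k, α i * β j * β k *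
        (r i * p j * (q i * r k - r i * q k) + p i * r k * (r i * q j - q i * r j)) =
      (∑ i, α i * q i * r i) * (∑ j, β j * p j) * (∑ k, β k * r k)
        + (∑ i, α i * p i * r i) * (∑ j, β j * q j) * (∑ k, β k * r k)
        - (∑ i, α i * r i * r i) * (∑ j, β j * p j) * (∑ k, β k * q k)
        - (∑ i, α i * p i * q i) * (∑ k, β k * r k) ^ 2 := by
  have key (A B C : ι → ℝ) :
      (∑ i, A i) * (∑ j, B j) * (∑ k, C k) = ∑ i, ∑ j, ∑ k, A i * B j * C k := by
    rw [Finset.sum_mul_sum, Finset.sum_mul]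
    exact Finset.sum_congr rfl fun i _ => Finset.sum_mul_sum ..
  rw [pow_two, ← mul_assoc]
  simp only [key, ← Finset.sum_add_distrib, ← Finset.sum_sub_distrib]
  refine Finset.sum_congr rfl fun i _ => Finset.sum_congr rfl fun j _ =>
    Finset.sum_congr rfl fun k _ => ?_
  ring

theorem sum_mul_sum_six {ι : Type*} [Fintype ι] (g h : ι → ι → ι → ℝ) :
    (∑ i, ∑ j, ∑ k, g i j k) * (∑ l, ∑ m, ∑ n, h l m n) =
      ∑ i, ∑ j, ∑ k, ∑ l, ∑ m, ∑ n, g i j k * h l m n := by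
  simp only [Finset.sum_mul]
  simp only [Finset.mul_sum]

/-- The Gaussian-curvature numerator of a one-hidden-layer network with 3D input as a
six-fold sum over hidden units.  Here `s1 i = σᵢ'` and `s2 i = σᵢ''` evaluated at the
pre-activation of hidden unit `i`. -/
theorem statement12 (d₁ : ℕ) (a : Fin d₁ → ℝ) (W : Fin d₁ → Fin 3 → ℝ) (b : Fin d₁ → ℝ)
    (c : ℝ) (σ : ℝ → ℝ) (hσ : ContDiff ℝ 2 σ) (f : ℝ → ℝ → ℝ → ℝ)
    (hf : ∀ x y z, f x y z = (∑ i, a i * σ (W i 0 * x + W i 1 * y + W i 2 * z + b i)) + c)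
    (x y z : ℝ) (s1 s2 : Fin d₁ → ℝ)
    (hs1 : ∀ i, s1 i = deriv σ (W i 0 * x + W i 1 * y + W i 2 * z + b i))
    (hs2 : ∀ i, s2 i = deriv (deriv σ) (W i 0 * x + W i 1 * y + W i 2 * z + b i)) :
    (2 * pdz3 (pdx3 f) x y z * pdx3 f x y z * pdz3 f x y z
        - pdx3 (pdx3 f) x y z * (pdz3 f x y z) ^ 2
        - pdz3 (pdz3 f) x y z * (pdx3 f x y z) ^ 2) *
      (2 * pdz3 (pdy3 f) x y z * pdy3 f x y z * pdz3 f x y z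
        - pdy3 (pdy3 f) x y z * (pdz3 f x y z) ^ 2
        - pdz3 (pdz3 f) x y z * (pdy3 f x y z) ^ 2)
      - (pdz3 (pdy3 f) x y z * pdx3 f x y z * pdz3 f x y z
        + pdz3 (pdx3 f) x y z * pdy3 f x y z * pdz3 f x y z
        - pdz3 (pdz3 f) x y z * pdx3 f x y z * pdy3 f x y z
        - pdy3 (pdx3 f) x y z * (pdz3 f x y z) ^ 2) ^ 2 =
    ∑ i, ∑ j, ∑ k, ∑ l, ∑ m, ∑ n,
      a i * a j * a k * a l * a m * a n *
        (s2 i * s1 j * s1 k * s2 l * s1 m * s1 n) *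
        ((W i 0 * W k 2 * (W i 2 * W j 0 - W i 0 * W j 2)
            + W i 2 * W j 0 * (W i 0 * W k 2 - W i 2 * W k 0)) *
          (W l 1 * W n 2 * (W l 2 * W m 1 - W l 1 * W m 2)
            + W l 2 * W m 1 * (W l 1 * W n 2 - W l 2 * W n 1))
        - (W i 2 * W j 0 * (W i 1 * W k 2 - W i 2 * W k 1)
            + W i 0 * W k 2 * (W i 2 * W j 1 - W i 1 * W j 2)) *
          (W l 2 * W m 0 * (W l 1 * W n 2 - W l 2 * W n 1)
            + W l 0 * W n 2 * (W l 2 * W m 1 - W l 1 * W m 2))) := by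
  have hσ0 : Differentiable ℝ σ := hσ.differentiable (by norm_num)
  have hσ1 : Differentiable ℝ (deriv σ) :=
    ((contDiff_succ_iff_deriv (n := 1)).1 hσ).2.2.differentiable (by norm_num)
  obtain rfl : f = fun x y z =>
      (∑ i, a i * σ (W i 0 * x + W i 1 * y + W i 2 * z + b i)) + c := by
    funext x y z
    exact hf x y z
  simp only [pdx3_network hσ0, pdy3_network hσ0, pdz3_network hσ0, pdx3_network hσ1,
    pdy3_network hσ1, pdz3_network hσ1]
  simp only [← hs1, ← hs2, add_zero]
  have hS := sum_sum_sum_curvature_form (fun i => a i * s2 i) (fun i => a i * s1 i)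
  have first (u : Fin 3) : ∑ i, a i * W i u * s1 i = ∑ i, a i * s1 i * W i u :=
    Finset.sum_congr rfl fun i _ => by ring
  have second (u v : Fin 3) :
      ∑ i, a i * W i u * W i v * s2 i = ∑ i, a i * s2 i * W i u * W i v :=
    Finset.sum_congr rfl fun i _ => by ring
  have hxx := hS (W · 0) (W · 0) (W · 2)
  have hyy := hS (W · 1) (W · 1) (W · 2)
  have hxy := hS (W · 0) (W · 1) (W · 2)
  simp only [first, second]
  trans (∑ i, ∑ j, ∑ k, a i * s2 i * (a j * s1 j) * (a k * s1 k) *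
        (W i 2 * W j 0 * (W i 0 * W k 2 - W i 2 * W k 0)
          + W i 0 * W k 2 * (W i 2 * W j 0 - W i 0 * W j 2))) *
      (∑ l, ∑ m, ∑ n, a l * s2 l * (a m * s1 m) * (a n * s1 n) *
        (W l 2 * W m 1 * (W l 1 * W n 2 - W l 2 * W n 1)
          + W l 1 * W n 2 * (W l 2 * W m 1 - W l 1 * W m 2)))
    - (∑ i, ∑ j, ∑ k, a i * s2 i * (a j * s1 j) * (a k * s1 k) *
        (W i 2 * W j 0 * (W i 1 * W k 2 - W i 2 * W k 1)
          + W i 0 * W k 2 * (W i 2 * W j 1 - W i 1 * W j 2))) *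
      (∑ l, ∑ m, ∑ n, a l * s2 l * (a m * s1 m) * (a n * s1 n) *
        (W l 2 * W m 0 * (W l 1 * W n 2 - W l 2 * W n 1)
          + W l 0 * W n 2 * (W l 2 * W m 1 - W l 1 * W m 2)))
  · rw [hxx, hyy, hxy]
    ring
  · simp only [sum_mul_sum_six, ← Finset.sum_sub_distrib]
    refine Finset.sum_congr rfl fun i _ => Finset.sum_congr rfl fun j _ =>
      Finset.sum_congr rfl fun k _ => Finset.sum_congr rfl fun l _ =>
      Finset.sum_congr rfl fun m _ => Finset.sum_congr rfl fun n _ => ?_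
    ring
end

section
/- Let f be a one-hidden-layer neural network with 3D input. Suppose either (a) there exists a column p ∈ {1, 2, 3} such that aᵢ W_{ip} = 0 for all i ∈ {1, …, d₁}, or (b) aᵢ aⱼ (W_{i3} W_{j2} − W_{i2} W_{j3}) = 0 for all i, j ∈ {1, …, d₁}. Then at every point of ℝ³: (2 f_x f_z f_xz − f_xx f_z² − f_zz f_x²)(2 f_y f_z f_yz − f_yy f_z² − f_zz f_y²) − (f_x f_z f_yz + f_y f_z f_xz − f_x f_y f_zz − f_xy f_z²)² = 0; consequently the Gaussian curvature K = [this expression] / [f_z² (f_x² + f_y² + f_z²)²] of the decision boundary is zero at every point where f_z ≠ 0. -/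
/-- The one-hidden-layer network with 3D input, outer weights `v`, and activation `τ`. -/
noncomputable def shallowNet {ι : Type*} [Fintype ι] (v : ι → ℝ) (W : ι → Fin 3 → ℝ) (b : ι → ℝ)
    (c : ℝ) (τ : ℝ → ℝ) (x y z : ℝ) : ℝ :=
  (∑ i, v i * τ (W i 0 * x + W i 1 * y + W i 2 * z + b i)) + c

section shallowNet

variable {ι : Type*} [Fintype ι]

theorem deriv_sum_mul_comp_affine_add_const {τ : ℝ → ℝ} (hτ : Differentiable ℝ τ)
    (v : ι → ℝ) (L : ι → ℝ → ℝ) (p : ι → ℝ) (t c : ℝ) (hL : ∀ i, HasDerivAt (L i) (p i) t) :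
    deriv (fun s => (∑ i, v i * τ (L i s)) + c) t = ∑ i, v i * p i * deriv τ (L i t) := by
  have h : HasDerivAt (fun s => ∑ i, v i * τ (L i s))
      (∑ i, v i * (deriv τ (L i t) * p i)) t :=
    HasDerivAt.fun_sum fun i _ =>
      ((hτ (L i t)).hasDerivAt.comp t (hL i)).const_mul (v i)
  rw [(h.add_const c).deriv]
  exact Finset.sum_congr rfl fun i _ => by ring

variable (v : ι → ℝ) (W : ι → Fin 3 → ℝ) (b : ι → ℝ) (c : ℝ) {τ : ℝ → ℝ}

theorem pdx3_shallowNet (hτ : Differentiable ℝ τ) :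
    pdx3 (shallowNet v W b c τ) = shallowNet (fun i => v i * W i 0) W b 0 (deriv τ) := by
  funext x y z
  simp only [pdx3, shallowNet, add_zero]
  exact deriv_sum_mul_comp_affine_add_const hτ v
    (fun i t => W i 0 * t + W i 1 * y + W i 2 * z + b i) (fun i => W i 0) x c fun i => by
      simpa using ((((hasDerivAt_id x).const_mul (W i 0)).add_const (W i 1 * y)).add_const
        (W i 2 * z)).add_const (b i)

theorem pdy3_shallowNet (hτ : Differentiable ℝ τ) :
    pdy3 (shallowNet v W b c τ) = shallowNet (fun i => v i * W i 1) W b 0 (deriv τ) := by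
  funext x y z
  simp only [pdy3, shallowNet, add_zero]
  exact deriv_sum_mul_comp_affine_add_const hτ v
    (fun i t => W i 0 * x + W i 1 * t + W i 2 * z + b i) (fun i => W i 1) y c fun i => by
      simpa using ((((hasDerivAt_id y).const_mul (W i 1)).const_add (W i 0 * x)).add_const
        (W i 2 * z)).add_const (b i)

theorem pdz3_shallowNet (hτ : Differentiable ℝ τ) :
    pdz3 (shallowNet v W b c τ) = shallowNet (fun i => v i * W i 2) W b 0 (deriv τ) := by
  funext x y z
  simp only [pdz3, shallowNet, add_zero]
  exact deriv_sum_mul_comp_affine_add_const hτ v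
    (fun i t => W i 0 * x + W i 1 * y + W i 2 * t + b i) (fun i => W i 2) z c fun i => by
      simpa using (((hasDerivAt_id z).const_mul (W i 2)).const_add
        (W i 0 * x + W i 1 * y)).add_const (b i)

theorem shallowNet_eq_mul {u : ι → ℝ} {v : ι → ℝ} {k : ℝ} (h : ∀ i, u i = k * v i) (x y z : ℝ) :
    shallowNet u W b 0 τ x y z = k * shallowNet v W b 0 τ x y z := by
  simp only [shallowNet, add_zero, Finset.mul_sum]
  exact Finset.sum_congr rfl fun i _ => by rw [h, mul_assoc]

theorem shallowNet_eq_zero {v : ι → ℝ} (h : ∀ i, v i = 0) (x y z : ℝ) :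
    shallowNet v W b 0 τ x y z = 0 := by
  simp [shallowNet, h]

end shallowNet

/-- Pairwise parallel second and third columns are either proportional or the third vanishes. -/
theorem columns_proportional_or_eq_zero {ι : Type*} {a : ι → ℝ} {W : ι → Fin 3 → ℝ}
    (h : ∀ i j, a i * a j * (W i 2 * W j 1 - W i 1 * W j 2) = 0) :
    (∃ k : ℝ, ∀ i, a i * W i 1 = k * (a i * W i 2)) ∨ ∀ i, a i * W i 2 = 0 := by
  by_cases hz : ∀ i, a i * W i 2 = 0
  · exact Or.inr hz
  · push Not at hz
    obtain ⟨j, hj⟩ := hz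
    refine Or.inl ⟨a j * W j 1 / (a j * W j 2), fun i => ?_⟩
    rw [div_mul_eq_mul_div, eq_div_iff hj]
    linear_combination -h i j

/-- Sufficient conditions on the parameters of a one-hidden-layer network with 3D input for
the Gaussian-curvature numerator to vanish identically, hence for the Gaussian curvature of
the decision boundary to be zero wherever `f_z ≠ 0`. -/
theorem statement13 (d₁ : ℕ) (a : Fin d₁ → ℝ) (W : Fin d₁ → Fin 3 → ℝ) (b : Fin d₁ → ℝ)
    (c : ℝ) (σ : ℝ → ℝ) (hσ : ContDiff ℝ 2 σ) (f : ℝ → ℝ → ℝ → ℝ)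
    (hf : ∀ x y z, f x y z = (∑ i, a i * σ (W i 0 * x + W i 1 * y + W i 2 * z + b i)) + c)
    (hW : (∃ p : Fin 3, ∀ i, a i * W i p = 0) ∨
      (∀ i j, a i * a j * (W i 2 * W j 1 - W i 1 * W j 2) = 0)) :
    (∀ x y z : ℝ,
      (2 * pdx3 f x y z * pdz3 f x y z * pdz3 (pdx3 f) x y z
          - pdx3 (pdx3 f) x y z * (pdz3 f x y z) ^ 2
          - pdz3 (pdz3 f) x y z * (pdx3 f x y z) ^ 2) *
        (2 * pdy3 f x y z * pdz3 f x y z * pdz3 (pdy3 f) x y z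
          - pdy3 (pdy3 f) x y z * (pdz3 f x y z) ^ 2
          - pdz3 (pdz3 f) x y z * (pdy3 f x y z) ^ 2)
        - (pdx3 f x y z * pdz3 f x y z * pdz3 (pdy3 f) x y z
          + pdy3 f x y z * pdz3 f x y z * pdz3 (pdx3 f) x y z
          - pdx3 f x y z * pdy3 f x y z * pdz3 (pdz3 f) x y z
          - pdy3 (pdx3 f) x y z * (pdz3 f x y z) ^ 2) ^ 2 = 0) ∧
    (∀ x y z : ℝ, pdz3 f x y z ≠ 0 →
      ((2 * pdx3 f x y z * pdz3 f x y z * pdz3 (pdx3 f) x y z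
          - pdx3 (pdx3 f) x y z * (pdz3 f x y z) ^ 2
          - pdz3 (pdz3 f) x y z * (pdx3 f x y z) ^ 2) *
        (2 * pdy3 f x y z * pdz3 f x y z * pdz3 (pdy3 f) x y z
          - pdy3 (pdy3 f) x y z * (pdz3 f x y z) ^ 2
          - pdz3 (pdz3 f) x y z * (pdy3 f x y z) ^ 2)
        - (pdx3 f x y z * pdz3 f x y z * pdz3 (pdy3 f) x y z
          + pdy3 f x y z * pdz3 f x y z * pdz3 (pdx3 f) x y z
          - pdx3 f x y z * pdy3 f x y z * pdz3 (pdz3 f) x y z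
          - pdy3 (pdx3 f) x y z * (pdz3 f x y z) ^ 2) ^ 2) /
      ((pdz3 f x y z) ^ 2 *
        ((pdx3 f x y z) ^ 2 + (pdy3 f x y z) ^ 2 + (pdz3 f x y z) ^ 2) ^ 2) = 0) := by
  obtain rfl : f = shallowNet a W b c σ := by
    funext x y z
    exact hf x y z
  have hσ₁ : Differentiable ℝ σ := hσ.differentiable (by norm_num)
  have hσ₂ : Differentiable ℝ (deriv σ) :=
    ((contDiff_succ_iff_deriv (n := 1)).1
      (by simpa [one_add_one_eq_two] using hσ)).2.2.differentiable
      (by norm_num)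
  rw [and_iff_left_of_imp fun h x y z _ => by rw [h x y z, zero_div]]
  intro x y z
  simp only [pdx3_shallowNet _ _ _ _ hσ₁, pdy3_shallowNet _ _ _ _ hσ₁,
    pdz3_shallowNet _ _ _ _ hσ₁, pdx3_shallowNet _ _ _ _ hσ₂, pdy3_shallowNet _ _ _ _ hσ₂,
    pdz3_shallowNet _ _ _ _ hσ₂]
  obtain ⟨p, h⟩ | ⟨k, h⟩ : (∃ p : Fin 3, ∀ i, a i * W i p = 0) ∨
      ∃ k : ℝ, ∀ i, a i * W i 1 = k * (a i * W i 2) := by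
    rcases hW with h | h
    · exact Or.inl h
    · exact (columns_proportional_or_eq_zero h).symm.imp_left fun h => ⟨2, h⟩
  · have first (τ : ℝ → ℝ) : shallowNet (fun i => a i * W i p) W b 0 τ x y z = 0 :=
      shallowNet_eq_zero W b h x y z
    have left (τ : ℝ → ℝ) (q : Fin 3) :
        shallowNet (fun i => a i * W i p * W i q) W b 0 τ x y z = 0 :=
      shallowNet_eq_zero W b (fun i => by rw [h, zero_mul]) x y z
    have right (τ : ℝ → ℝ) (q : Fin 3) :
        shallowNet (fun i => a i * W i q * W i p) W b 0 τ x y z = 0 :=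
      shallowNet_eq_zero W b (fun i => by rw [mul_right_comm, h, zero_mul]) x y z
    obtain rfl | rfl | rfl : p = 0 ∨ p = 1 ∨ p = 2 := by lia
    all_goals
      simp only [first, left, right]
      ring
  · have hy := shallowNet_eq_mul W b (τ := deriv σ) h x y z
    have hxy := shallowNet_eq_mul W b (τ := deriv (deriv σ))
      (u := fun i => a i * W i 0 * W i 1) (v := fun i => a i * W i 0 * W i 2)
      (fun i => by linear_combination W i 0 * h i) x y z
    have hyz := shallowNet_eq_mul W b (τ := deriv (deriv σ))
      (u := fun i => a i * W i 1 * W i 2) (v := fun i => a i * W i 2 * W i 2)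
      (fun i => by linear_combination W i 2 * h i) x y z
    have hyy := shallowNet_eq_mul W b (τ := deriv (deriv σ))
      (u := fun i => a i * W i 1 * W i 1) (v := fun i => a i * W i 1 * W i 2)
      (fun i => by linear_combination W i 1 * h i) x y z
    rw [hyy, hyz, hxy, hy]
    ring
end
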